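/- arXiv:2407.01632 — 4 statements merged into one kernel-verified Lean document; each statement's English description precedes it below -/
import Mathlib

section
/- Let f : ℤ × ℤ → ℂ satisfy f(-k₁, k₂) = f(k₁, k₂) for all (k₁, k₂) ∈ ℤ² and f(0,0) = 0. Then there exists a unique u : ℤ × ℤ → ℂ with u(-k₁, k₂) = -u(k₁, k₂) for all (k₁, k₂) ∈ ℤ² such that for every (k₁, k₂) ∈ ℤ² one has k₁·u(k₁, k₂) + (k₂/2)·(u(k₁-1, k₂) - u(k₁+1, k₂)) = f(k₁, k₂). -/
/-- The solution, at nonnegative indices, of the recurrence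
`n * v n + c * (v (n - 1) - v (n + 1)) = g n` for odd `v` and `c ≠ 0`. -/
noncomputable def mizohataSeq (c : ℂ) (g : ℤ → ℂ) : ℕ → ℂ
  | 0 => 0
  | 1 => -g 0 / (2 * c)
  | n + 2 => mizohataSeq c g n + ((n + 1) * mizohataSeq c g (n + 1) - g (n + 1)) / c

/-- For an odd function `v` and even `g`, it suffices to check the recurrence at
nonnegative indices. -/
theorem mizohata_of_nat {c : ℂ} {g v : ℤ → ℂ} (hg : ∀ k, g (-k) = g k)
    (hv : ∀ k, v (-k) = -v k)
    (h : ∀ n : ℕ, (n : ℂ) * v n + c * (v (n - 1) - v (n + 1)) = g n) (k : ℤ) :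
    (k : ℂ) * v k + c * (v (k - 1) - v (k + 1)) = g k := by
  obtain ⟨n, rfl | rfl⟩ := k.eq_nat_or_neg
  · exact_mod_cast h n
  · have h₁ : v (-(n : ℤ) - 1) = -v (n + 1) := by rw [← hv]; congr 1; ring
    have h₂ : v (-(n : ℤ) + 1) = -v (n - 1) := by rw [← hv]; congr 1; ring
    rw [hg, hv, h₁, h₂, ← h n]
    push_cast
    ring

theorem exists_mizohata_of_ne_zero {c : ℂ} (hc : c ≠ 0) {g : ℤ → ℂ}
    (hg : ∀ k, g (-k) = g k) :
    ∃ v : ℤ → ℂ, (∀ k, v (-k) = -v k) ∧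
      ∀ k : ℤ, (k : ℂ) * v k + c * (v (k - 1) - v (k + 1)) = g k := by
  let v : ℤ → ℂ := fun k => k.sign * mizohataSeq c g k.natAbs
  have hodd : ∀ k, v (-k) = -v k := fun k => by simp [v]
  have hnat : ∀ n : ℕ, v n = mizohataSeq c g n := by
    rintro (_ | n)
    · simp [v, mizohataSeq]
    · simp only [v, Int.natAbs_natCast]
      simp
  refine ⟨v, hodd, mizohata_of_nat hg hodd ?_⟩
  rintro (_ | n)
  · have h₁ : v 1 = -g 0 / (2 * c) := by simpa [mizohataSeq] using hnat 1
    simp only [Nat.cast_zero, zero_mul, zero_add, zero_sub, hodd, h₁]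
    field_simp
    ring
  · have h₁ : v ((n + 1 : ℕ) - 1) = mizohataSeq c g n := by rw [← hnat]; simp
    have h₂ : v ((n + 1 : ℕ) + 1) = mizohataSeq c g (n + 2) := by rw [← hnat]; rfl
    rw [h₁, h₂, hnat, mizohataSeq]
    push_cast
    field_simp
    ring

/-- One-variable form of the theorem, for a fixed second frequency. -/
theorem existsUnique_mizohata {c : ℂ} {g : ℤ → ℂ} (hg : ∀ k, g (-k) = g k)
    (hg0 : c = 0 → g 0 = 0) :
    ∃! v : ℤ → ℂ, (∀ k, v (-k) = -v k) ∧
      ∀ k : ℤ, (k : ℂ) * v k + c * (v (k - 1) - v (k + 1)) = g k := by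
  have hzero : ∀ v : ℤ → ℂ, (∀ k, v (-k) = -v k) → v 0 = 0 := fun v hv =>
    self_eq_neg.mp (by simpa using hv 0)
  obtain rfl | hc := eq_or_ne c 0
  · refine ⟨fun k => g k / k, ⟨fun k => ?_, fun k => ?_⟩, ?_⟩
    · simp [hg, div_neg]
    · obtain rfl | hk := eq_or_ne k 0
      · simp [hg0]
      · have : (k : ℂ) ≠ 0 := by exact_mod_cast hk
        simp only [zero_mul, add_zero]
        field_simp
    · rintro v ⟨hodd, hv⟩
      funext k
      obtain rfl | hk := eq_or_ne k 0
      · simp [hzero v hodd]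
      · have : (k : ℂ) ≠ 0 := by exact_mod_cast hk
        rw [eq_div_iff this, ← hv k]
        ring
  · refine existsUnique_of_exists_of_unique (exists_mizohata_of_ne_zero hc hg) ?_
    rintro v w ⟨hv, hv'⟩ ⟨hw, hw'⟩
    have key : ∀ n : ℕ, v n = w n ∧ v (n + 1) = w (n + 1) := by
      intro n
      induction n with
      | zero =>
        have h₁ := hv' 0
        have h₂ := hw' 0
        simp only [Int.cast_zero, zero_mul, zero_add, zero_sub, hv, hw] at h₁ h₂
        refine ⟨by simp [hzero v hv, hzero w hw], mul_left_cancel₀ hc ?_⟩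
        simp only [Nat.cast_zero, zero_add]
        linear_combination (h₂ - h₁) / 2
      | succ n ih =>
        have h₁ := hv' (n + 1)
        have h₂ := hw' (n + 1)
        rw [add_sub_cancel_right, ih.1, ih.2] at h₁
        rw [add_sub_cancel_right] at h₂
        push_cast
        exact ⟨ih.2, mul_left_cancel₀ hc (by linear_combination h₂ - h₁)⟩
    funext k
    obtain ⟨n, rfl | rfl⟩ := k.eq_nat_or_neg
    · exact (key n).1
    · rw [hv, hw, (key n).1]

/-- For every `f : ℤ × ℤ → ℂ` even in the first variable with `f (0,0) = 0`,
there is a unique `u` odd in the first variable solving the Fourier-side periodic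
Mizohata recurrence `k₁·u(k₁,k₂) + (k₂/2)·(u(k₁-1,k₂) - u(k₁+1,k₂)) = f(k₁,k₂)`. -/
theorem stmt_0 (f : ℤ × ℤ → ℂ)
    (hf_even : ∀ k : ℤ × ℤ, f (-k.1, k.2) = f (k.1, k.2))
    (hf0 : f (0, 0) = 0) :
    ∃! u : ℤ × ℤ → ℂ,
      (∀ k : ℤ × ℤ, u (-k.1, k.2) = -u (k.1, k.2)) ∧
      (∀ k : ℤ × ℤ,
        (k.1 : ℂ) * u (k.1, k.2)
          + (k.2 : ℂ) / 2 * (u (k.1 - 1, k.2) - u (k.1 + 1, k.2)) = f (k.1, k.2)) := by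
  have h := fun m : ℤ => existsUnique_mizohata (c := (m : ℂ) / 2) (g := fun k => f (k, m))
    (fun k => hf_even (k, m)) (fun hm => by
      obtain rfl : m = 0 := by simpa using hm
      exact hf0)
  choose v hv huniq using h
  refine ⟨fun k => v k.2 k.1, ⟨fun k => (hv k.2).1 k.1, fun k => (hv k.2).2 k.1⟩, ?_⟩
  rintro u ⟨hodd, hu⟩
  funext k
  exact congrFun (huniq k.2 (fun j => u (j, k.2))
    ⟨fun j => hodd (j, k.2), fun j => hu (j, k.2)⟩) k.1
end

section
/- Let u : ℤ × ℤ → ℂ satisfy the homogeneous recurrence k₁·u(k₁, k₂) + (k₂/2)·(u(k₁-1, k₂) - u(k₁+1, k₂)) = 0 for all (k₁, k₂) ∈ ℤ². Then u is even in the first variable: u(-k₁, k₂) = u(k₁, k₂) for all (k₁, k₂) ∈ ℤ². -/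
/-- A solution `f` of `m·f(m) + c·(f(m-1) - f(m+1)) = 0` on `ℤ` with `c ≠ 0` is even. -/
lemma even_of_three_term_recurrence {c : ℂ} (hc : c ≠ 0) (f : ℤ → ℂ)
    (hf : ∀ m : ℤ, (m : ℂ) * f m + c * (f (m - 1) - f (m + 1)) = 0) :
    Function.Even f := by
  have key : ∀ n : ℕ, f (-(n : ℤ)) = f n ∧ f (-((n : ℤ) + 1)) = f (n + 1) := by
    intro n
    induction n with
    | zero =>
      have h := hf 0
      simp only [Int.cast_zero, zero_mul, zero_add, zero_sub, mul_eq_zero, hc, false_or] at h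
      exact ⟨by simp, by simpa using sub_eq_zero.mp h⟩
    | succ n ih =>
      obtain ⟨ih₀, ih₁⟩ := ih
      refine ⟨by exact_mod_cast ih₁, ?_⟩
      have h₁ := hf (n + 1)
      have h₂ := hf (-((n : ℤ) + 1))
      rw [show (n : ℤ) + 1 - 1 = n by ring] at h₁
      rw [show -((n : ℤ) + 1) - 1 = -((n : ℤ) + 1 + 1) by ring,
        show -((n : ℤ) + 1) + 1 = -(n : ℤ) by ring, ih₀, ih₁] at h₂
      push_cast at h₁ h₂ ⊢
      apply mul_left_cancel₀ hc
      linear_combination h₁ + h₂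
  intro m
  obtain ⟨n, rfl | rfl⟩ := m.eq_nat_or_neg
  · exact (key n).1
  · rw [neg_neg]
    exact (key n).1.symm

/-- Every solution of the homogeneous periodic Mizohata recurrence
`k₁·u(k₁,k₂) + (k₂/2)·(u(k₁-1,k₂) - u(k₁+1,k₂)) = 0` is even in the first variable. -/
theorem stmt_2 (u : ℤ × ℤ → ℂ)
    (hu : ∀ k : ℤ × ℤ,
      (k.1 : ℂ) * u (k.1, k.2)
        + (k.2 : ℂ) / 2 * (u (k.1 - 1, k.2) - u (k.1 + 1, k.2)) = 0) :
    ∀ k : ℤ × ℤ, u (-k.1, k.2) = u (k.1, k.2) := by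
  rintro ⟨a, b⟩
  by_cases hb : b = 0
  · subst hb
    by_cases ha : a = 0
    · simp [ha]
    · have h₁ := hu (a, 0)
      have h₂ := hu (-a, 0)
      simp [ha] at h₁ h₂
      simp [h₁, h₂]
  · have hc : (b : ℂ) / 2 ≠ 0 := div_ne_zero (Int.cast_ne_zero.mpr hb) two_ne_zero
    exact even_of_three_term_recurrence hc (fun m => u (m, b)) (fun m => hu (m, b)) a
end

section
/- Let u, v : ℤ × ℤ → ℂ both satisfy the homogeneous recurrence k₁·w(k₁, k₂) + (k₂/2)·(w(k₁-1, k₂) - w(k₁+1, k₂)) = 0 for all (k₁, k₂) ∈ ℤ². If u(0, k₂) = v(0, k₂) and u(1, k₂) = v(1, k₂) for every k₂ ∈ ℤ, then u = v. In other words, every solution of the homogeneous equation is uniquely determined by its Fourier coefficient columns at k₁ = 0 and k₁ = 1 (i.e., by the functions u₀(x₂) = ⟨u, 1⟩_{x₁} and u₁(x₂) = ⟨u, e^{i x₁}⟩_{x₁}). -/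
/-- A solution of the homogeneous periodic Mizohata recurrence is uniquely
determined by its Fourier coefficient columns at `k₁ = 0` and `k₁ = 1`. -/
theorem stmt_3 (u v : ℤ × ℤ → ℂ)
    (hu : ∀ k : ℤ × ℤ,
      (k.1 : ℂ) * u (k.1, k.2)
        + (k.2 : ℂ) / 2 * (u (k.1 - 1, k.2) - u (k.1 + 1, k.2)) = 0)
    (hv : ∀ k : ℤ × ℤ,
      (k.1 : ℂ) * v (k.1, k.2)
        + (k.2 : ℂ) / 2 * (v (k.1 - 1, k.2) - v (k.1 + 1, k.2)) = 0)
    (h0 : ∀ k₂ : ℤ, u (0, k₂) = v (0, k₂))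
    (h1 : ∀ k₂ : ℤ, u (1, k₂) = v (1, k₂)) :
    u = v := by
  funext ⟨a, b⟩
  rcases eq_or_ne b 0 with rfl | hb
  · rcases eq_or_ne a 0 with rfl | ha
    · exact h0 0
    · have ha' : (a : ℂ) ≠ 0 := Int.cast_ne_zero.mpr ha
      have eu := hu (a, 0)
      have ev := hv (a, 0)
      simp only [Int.cast_zero, zero_div, zero_mul, add_zero, mul_eq_zero, ha', false_or] at eu ev
      rw [eu, ev]
  · have hb' : (b : ℂ) ≠ 0 := Int.cast_ne_zero.mpr hb
    have consecutive : ∀ j : ℤ, u (j, b) = v (j, b) ∧ u (j + 1, b) = v (j + 1, b) := by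
      intro j
      induction j using Int.induction_on with
      | zero => exact ⟨h0 b, by simpa using h1 b⟩
      | succ n ih =>
        refine ⟨ih.2, mul_left_cancel₀ hb' ?_⟩
        have eu := hu ((n : ℤ) + 1, b)
        have ev := hv ((n : ℤ) + 1, b)
        simp only [add_sub_cancel_right, ih.1, ih.2] at eu ev
        linear_combination 2 * ev - 2 * eu
      | pred n ih =>
        refine ⟨mul_left_cancel₀ hb' ?_, by simpa using ih.1⟩
        have eu := hu (-(n : ℤ), b)
        have ev := hv (-(n : ℤ), b)
        simp only [ih.1, ih.2] at eu ev
        linear_combination 2 * eu - 2 * ev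
    exact (consecutive a).1
end

section
/- Let P be a homogeneous polynomial of degree p ≥ 2 in two variables with integer coefficients that is irreducible over the field ℚ (so that all real roots of x ↦ P(x,1) are simple, i.e., the greatest multiplicity r of its real roots equals 1). Then for every ε > 0 there exists C > 0 such that |P(n₁, n₂)| ≥ C·(n₁² + n₂²)^{(p/2 − 1 − ε)/2} for all (n₁, n₂) ∈ ℤ × ℤ with (n₁, n₂) ≠ (0,0). Equivalently, the inverse operator L⁻¹ acts continuously from the Sobolev space H^m on the torus into H^{m + p/2 − 1 − ε} (modulo constants) for every m and every ε > 0. -/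
open Polynomial

theorem X_sub_C_pow_dvd_iff_hasseDeriv {R : Type*} [CommRing R] {p : R[X]} {a : R} {k : ℕ} :
    (X - C a) ^ k ∣ p ↔ ∀ j < k, (hasseDeriv j p).eval a = 0 := by
  simp_rw [X_sub_C_pow_dvd_iff, X_pow_dvd_iff, ← taylor_coeff, taylor_apply]

theorem map_hasseDeriv {R S : Type*} [CommRing R] [CommRing S] (φ : R →+* S) (j : ℕ) (p : R[X]) :
    (hasseDeriv j p).map φ = hasseDeriv j (p.map φ) := by
  ext i; simp [hasseDeriv_coeff]

theorem eval_hasseDeriv_eq_sum {R : Type*} [CommRing R] {p : R[X]} {M : ℕ} (hp : p.degree < M)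
    (a : R) (j : ℕ) :
    (hasseDeriv j p).eval a = ∑ i ∈ Finset.range M, (i.choose j : R) * p.coeff i * a ^ (i - j) := by
  rcases eq_or_ne p 0 with rfl | h
  · simp
  rw [hasseDeriv_apply, sum_over_range' _ (by simp) M ((natDegree_lt_iff_degree_lt h).2 hp),
    eval_finsetSum]
  simp [eval_monomial]

theorem exists_reduced_pow {f : ℤ[X]} (hf : f.Monic) (hd : 1 ≤ f.natDegree) {α : ℝ}
    (hα : aeval α f = 0) :
    ∃ H : ℤ, 1 ≤ H ∧ ∀ n : ℕ, ∃ g : ℤ[X], g.natDegree < f.natDegree ∧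
      (∀ l, |g.coeff l| ≤ H ^ n) ∧ aeval α g = α ^ n := by
  have hS : 0 ≤ ∑ i ∈ f.support, |f.coeff i| := Finset.sum_nonneg fun i _ => abs_nonneg _
  refine ⟨1 + ∑ i ∈ f.support, |f.coeff i|, by linarith, fun n => ?_⟩
  set S := ∑ i ∈ f.support, |f.coeff i|
  have hfS : ∀ l, |f.coeff l| ≤ S := fun l => by
    by_cases hl : l ∈ f.support
    · exact Finset.single_le_sum (f := fun i => |f.coeff i|) (fun i _ => abs_nonneg _) hl
    · rw [notMem_support_iff.1 hl]; simpa using hS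
  induction n with
  | zero =>
    refine ⟨1, by rw [natDegree_one]; exact hd, fun l => ?_, by simp⟩
    rw [coeff_one]; split_ifs <;> simp
  | succ n ih =>
    obtain ⟨g, hg, hgc, hgα⟩ := ih
    have hH : (0 : ℤ) ≤ (1 + S) ^ n := by positivity
    refine ⟨X * g - C (g.coeff (f.natDegree - 1)) * f, ?_, fun l => ?_, ?_⟩
    · refine Nat.lt_of_le_sub_one hd (natDegree_le_iff_coeff_eq_zero.2 fun m hm => ?_)
      obtain ⟨m, rfl⟩ : ∃ m', m = m' + 1 := ⟨m - 1, by omega⟩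
      rw [coeff_sub, coeff_X_mul, coeff_C_mul]
      rcases (show f.natDegree ≤ m + 1 by omega).eq_or_lt with h | h
      · have : f.coeff (m + 1) = 1 := by rw [← h]; exact hf
        rw [this, h]; simp
      · rw [coeff_eq_zero_of_natDegree_lt (p := g) (by omega),
          coeff_eq_zero_of_natDegree_lt (p := f) (by omega)]; simp
    · rw [coeff_sub, coeff_C_mul]
      have h1 : |(X * g).coeff l| ≤ (1 + S) ^ n := by
        cases l with
        | zero => simpa using hH
        | succ l => rw [coeff_X_mul]; exact hgc l
      have h2 : |g.coeff (f.natDegree - 1) * f.coeff l| ≤ (1 + S) ^ n * S := by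
        rw [abs_mul]; exact mul_le_mul (hgc _) (hfS l) (abs_nonneg _) hH
      calc _ ≤ _ := abs_sub _ _
        _ ≤ (1 + S) ^ n + (1 + S) ^ n * S := add_le_add h1 h2
        _ = _ := by ring
    · simp [hα, hgα, pow_succ, mul_comm]

/-- Thue's auxiliary polynomial `P(x) - y Q(x)`, vanishing to high order at `(α, α)`, with integer
coefficients bounded exponentially in `s`. -/
theorem exists_auxiliary_pair {f : ℤ[X]} (hf : f.Monic) (hd : 1 ≤ f.natDegree) {α : ℝ}
    (hα : aeval α f = 0) (N : ℕ) (hN : 1 ≤ N) :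
    ∃ K : ℝ, 1 ≤ K ∧ ∀ s : ℕ, 1 ≤ s → ∃ P Q : ℤ[X], (P ≠ 0 ∨ Q ≠ 0) ∧
      P.degree < (f.natDegree * (N + 1) * s : ℕ) ∧ Q.degree < (f.natDegree * (N + 1) * s : ℕ) ∧
      (∀ i, |(P.coeff i : ℝ)| ≤ K ^ s) ∧ (∀ i, |(Q.coeff i : ℝ)| ≤ K ^ s) ∧
      (X - C α) ^ (2 * N * s) ∣
        P.map (algebraMap ℤ ℝ) - C α * Q.map (algebraMap ℤ ℝ) := by
  obtain ⟨H, hH, hg⟩ := exists_reduced_pow hf hd hα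
  choose g hgd hgc hgα using hg
  set d := f.natDegree
  have hHR : (1 : ℝ) ≤ H := by exact_mod_cast hH
  refine ⟨(8 * H : ℝ) ^ (d * (N + 1) * N), one_le_pow₀ (by linarith), fun s hs => ?_⟩
  set M := d * (N + 1) * s with hM
  have hM1 : 1 ≤ M := Nat.mul_pos (Nat.mul_pos hd (by omega)) hs
  let A : Matrix (Fin (2 * N * s) × Fin d) (Fin M ⊕ Fin M) ℤ := Matrix.of fun jl i =>
    Sum.elim (fun i : Fin M => ((i : ℕ).choose jl.1 : ℤ) * (g (i - jl.1)).coeff jl.2)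
      (fun i : Fin M => -(((i : ℕ).choose jl.1 : ℤ) * (g (i - jl.1 + 1)).coeff jl.2)) i
  have hbound : ∀ (i : Fin M) (j e l : ℕ), e ≤ M →
      |((i : ℕ).choose j : ℤ) * (g e).coeff l| ≤ 2 ^ M * H ^ M := by
    intro i j e l he
    rw [abs_mul]
    refine mul_le_mul ?_ ((hgc e l).trans (pow_le_pow_right₀ hH he)) (abs_nonneg _) (by positivity)
    rw [abs_of_nonneg (by positivity)]
    have : (i : ℕ).choose j ≤ 2 ^ M :=
      (Nat.choose_le_two_pow _ _).trans (Nat.pow_le_pow_right (by norm_num) i.2.le)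
    exact_mod_cast this
  let _ : SeminormedAddCommGroup (Matrix (Fin (2 * N * s) × Fin d) (Fin M ⊕ Fin M) ℤ) :=
    Matrix.seminormedAddCommGroup
  have hA : ‖A‖ ≤ (2 * H : ℝ) ^ M := by
    rw [Matrix.norm_le_iff (by positivity)]
    rintro ⟨j, l⟩ (i | i)
    · have := hbound i j (i - j) l (by omega)
      rw [Int.norm_eq_abs, mul_pow]
      exact_mod_cast this
    · have := hbound i j (i - j + 1) l (by omega)
      rw [← abs_neg] at this
      rw [Int.norm_eq_abs, mul_pow]
      exact_mod_cast this
  have hcard : Fintype.card (Fin (2 * N * s) × Fin d) = 2 * N * s * d := by simp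
  have hcard' : Fintype.card (Fin M ⊕ Fin M) = 2 * N * s * d + 2 * d * s := by
    simp [hM]; ring
  have hds : 0 < d * s := Nat.mul_pos hd hs
  obtain ⟨t, ht0, htA, ht⟩ := Int.Matrix.exists_ne_zero_int_vec_norm_le A
    (by rw [hcard, hcard']; nlinarith)
    (by rw [hcard]; exact Nat.mul_pos (Nat.mul_pos (by omega) hs) hd)
  have hexp : ((Fintype.card (Fin (2 * N * s) × Fin d) : ℕ) : ℝ) /
      ((Fintype.card (Fin M ⊕ Fin M) : ℕ) - (Fintype.card (Fin (2 * N * s) × Fin d) : ℕ)) = N := by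
    rw [hcard, hcard']
    push_cast
    have : (d : ℝ) * s ≠ 0 := by exact_mod_cast hds.ne'
    rw [add_sub_cancel_left, div_eq_iff (fun h => this (by linarith))]
    ring
  have htK : ‖t‖ ≤ ((8 * H : ℝ) ^ (d * (N + 1) * N)) ^ s := by
    refine ht.trans ?_
    rw [hexp, Real.rpow_natCast, ← pow_mul,
      show d * (N + 1) * N * s = M * N by rw [hM]; ring, pow_mul]
    gcongr
    have h1 : max 1 ‖A‖ ≤ (2 * H : ℝ) ^ M := max_le (one_le_pow₀ (by linarith)) hA
    have h2 : ((Fintype.card (Fin M ⊕ Fin M) : ℕ) : ℝ) ≤ 4 ^ M := by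
      have : 2 * M ≤ 4 ^ M := by
        have h3 : M < 2 ^ M := Nat.lt_two_pow_self
        have h4 : 2 ≤ 2 ^ M := by simpa using Nat.pow_le_pow_right (n := 2) (by norm_num) hM1
        calc 2 * M ≤ 2 ^ M * 2 ^ M := Nat.mul_le_mul h4 h3.le
          _ = 4 ^ M := by rw [← mul_pow]; norm_num
      simp only [Fintype.card_sum, Fintype.card_fin]
      exact_mod_cast (by omega : M + M ≤ 4 ^ M)
    calc _ ≤ (4 : ℝ) ^ M * (2 * H : ℝ) ^ M := by gcongr
      _ = _ := by rw [← mul_pow]; ring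
  have htc : ∀ i, |(t i : ℝ)| ≤ ((8 * H : ℝ) ^ (d * (N + 1) * N)) ^ s := fun i => by
    rw [← Int.norm_eq_abs]; exact (norm_le_pi_norm t i).trans htK
  have hcoeff : ∀ (v : Fin M → ℤ), (∀ i, |(v i : ℝ)| ≤ ((8 * H : ℝ) ^ (d * (N + 1) * N)) ^ s) →
      ∀ i, |((ofFn M v).coeff i : ℝ)| ≤ ((8 * H : ℝ) ^ (d * (N + 1) * N)) ^ s := by
    intro v hv i
    by_cases hi : i < M
    · rw [ofFn_coeff_eq_val_of_lt v hi]; exact hv _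
    · rw [ofFn_coeff_eq_zero_of_ge v (by omega)]; simp; positivity
  refine ⟨ofFn M fun i => t (Sum.inl i), ofFn M fun i => t (Sum.inr i), ?_, ofFn_degree_lt _,
    ofFn_degree_lt _, hcoeff _ fun i => htc _, hcoeff _ fun i => htc _,
    X_sub_C_pow_dvd_iff_hasseDeriv.2 fun j hj => ?_⟩
  · by_contra! h
    apply ht0
    have h1 := injective_ofFn M (h.1.trans (map_zero _).symm)
    have h2 := injective_ofFn M (h.2.trans (map_zero _).symm)
    funext i
    rcases i with i | i
    · exact congrFun h1 i
    · exact congrFun h2 i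
  · have hpow : ∀ n, α ^ n = ∑ l : Fin d, ((g n).coeff l : ℝ) * α ^ (l : ℕ) := fun n => by
      rw [← hgα n, aeval_eq_sum_range' (hgd n), Finset.sum_range]
      simp
    rw [← smul_eq_C_mul, map_sub, map_smul, eval_sub, eval_smul, smul_eq_mul,
      eval_hasseDeriv_eq_sum (degree_map_le.trans_lt (ofFn_degree_lt _)),
      eval_hasseDeriv_eq_sum (degree_map_le.trans_lt (ofFn_degree_lt _)),
      Finset.sum_range, Finset.sum_range, Finset.mul_sum]
    simp_rw [coeff_map, eq_intCast]
    have hrow : ∀ l : Fin d,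
        ∑ i : Fin M, (((i : ℕ).choose j : ℝ) * (g (i - j)).coeff l * t (Sum.inl i)) -
        ∑ i : Fin M, (((i : ℕ).choose j : ℝ) * (g (i - j + 1)).coeff l * t (Sum.inr i)) = 0 := by
      intro l
      have := congrFun htA (⟨j, hj⟩, l)
      simp only [Matrix.mulVec, dotProduct, Fintype.sum_sum_type, A, Matrix.of_apply, Sum.elim_inl,
        Sum.elim_inr, Pi.zero_apply, neg_mul, Finset.sum_neg_distrib, ← sub_eq_add_neg] at this
      exact_mod_cast this
    calc _ = ∑ l : Fin d,
        (∑ i : Fin M, (((i : ℕ).choose j : ℝ) * (g (i - j)).coeff l * t (Sum.inl i)) -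
          ∑ i : Fin M, (((i : ℕ).choose j : ℝ) * (g (i - j + 1)).coeff l * t (Sum.inr i))) *
            α ^ (l : ℕ) := by
          simp_rw [sub_mul, Finset.sum_mul]
          rw [Finset.sum_sub_distrib, Finset.sum_comm]
          rw [Finset.sum_comm (f := fun (l : Fin d) (i : Fin M) =>
            (((i : ℕ).choose j : ℝ) * (g (i - j + 1)).coeff l * t (Sum.inr i)) * α ^ (l : ℕ))]
          congr 1 <;> refine Finset.sum_congr rfl fun i _ => ?_
          · rw [ofFn_coeff_eq_val_of_lt _ i.2, hpow, Finset.mul_sum]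
            exact Finset.sum_congr rfl fun l _ => by ring
          · rw [ofFn_coeff_eq_val_of_lt _ i.2]
            calc _ = ((i : ℕ).choose j : ℝ) * t (Sum.inr i) * α ^ ((i : ℕ) - j + 1) := by ring
              _ = _ := by
                rw [hpow, Finset.mul_sum]
                exact Finset.sum_congr rfl fun l _ => by ring
      _ = 0 := by simp [hrow]

theorem exists_map_eq_X_sub_C_mul {f : ℚ[X]} (hf : Irreducible f) {α : ℝ}
    (hα : aeval α f = 0) :
    ∃ u : ℝ[X], f.map (algebraMap ℚ ℝ) = (X - C α) * u ∧ u.eval α ≠ 0 := by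
  obtain ⟨u, hu⟩ : X - C α ∣ f.map (algebraMap ℚ ℝ) := by
    rw [dvd_iff_isRoot, IsRoot, eval_map, ← aeval_def, hα]
  refine ⟨u, hu, fun hu0 => ?_⟩
  have h1 := hf.separable.aeval_derivative_ne_zero hα
  rw [aeval_def, ← eval_map, ← derivative_map, hu] at h1
  simp [hu0] at h1

theorem pow_dvd_of_X_sub_C_pow_dvd {f : ℚ[X]} (hf : Irreducible f) {α : ℝ}
    (hα : aeval α f = 0) (k : ℕ) (g : ℚ[X])
    (h : (X - C α) ^ k ∣ g.map (algebraMap ℚ ℝ)) : f ^ k ∣ g := by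
  induction k generalizing g with
  | zero => simp
  | succ k ih =>
    have hroot : aeval α g = 0 := by
      rw [aeval_def, ← eval_map]
      exact dvd_iff_isRoot.1 ((dvd_pow_self _ k.succ_ne_zero).trans h)
    obtain ⟨g, rfl⟩ : f ∣ g :=
      (Dvd.intro _ (minpoly.eq_of_irreducible hf hα)).trans (minpoly.dvd ℚ α hroot)
    obtain ⟨u, hu, hu0⟩ := exists_map_eq_X_sub_C_mul hf hα
    replace hu0 : ¬ (X - C α ∣ u) := fun h => hu0 (dvd_iff_isRoot.1 h)
    rw [Polynomial.map_mul, hu, pow_succ', mul_assoc,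
      mul_dvd_mul_iff_left (X_sub_C_ne_zero α)] at h
    rw [pow_succ']
    exact mul_dvd_mul_left _ (ih _ ((((irreducible_X_sub_C α).coprime_iff_not_dvd.2
      hu0).pow_left).dvd_of_dvd_mul_left h))

theorem pow_sub_one_dvd_wronskian {R : Type*} [CommRing R] {a r : R[X]} (q : R[X]) {k : ℕ}
    (h : a ^ k ∣ r) : a ^ (k - 1) ∣ wronskian r q :=
  dvd_sub (((pow_dvd_pow a (Nat.sub_le k 1)).trans h).mul_right _)
    ((pow_sub_one_dvd_derivative_of_pow_dvd h).mul_right _)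

theorem wronskian_sub_C_mul {R : Type*} [CommRing R] (p q : R[X]) (c : R) :
    wronskian (p - C c * q) q = wronskian p q := by
  simp only [wronskian, derivative_sub, derivative_C_mul]; ring

theorem wronskian_map {R S : Type*} [CommRing R] [CommRing S] (φ : R →+* S) (p q : R[X]) :
    (wronskian p q).map φ = wronskian (p.map φ) (q.map φ) := by
  simp [wronskian, derivative_map]

theorem wronskian_ne_zero_of_X_sub_C_pow_dvd {f : ℚ[X]} (hf : Irreducible f) {α : ℝ}
    (hα : aeval α f = 0) (hirr : Irrational α) {p q : ℚ[X]} (hpq : p ≠ 0 ∨ q ≠ 0) {M k : ℕ}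
    (hp : p.degree < M) (hq : q.degree < M) (hM : M ≤ f.natDegree * k)
    (h : (X - C α) ^ k ∣ p.map (algebraMap ℚ ℝ) - C α * q.map (algebraMap ℚ ℝ)) :
    wronskian p q ≠ 0 := by
  intro hW
  have hgcd : gcd p q ≠ 0 := by rw [Ne, gcd_eq_zero_iff]; tauto
  obtain ⟨p', hp'⟩ := gcd_dvd_left p q
  obtain ⟨q', hq'⟩ := gcd_dvd_right p q
  set g := gcd p q with hg
  have hcop : IsCoprime p' q' := by
    obtain ⟨a, b, hab⟩ : ∃ a b, g = p * a + q * b := exists_gcd_eq_mul_add_mul p q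
    refine ⟨a, b, mul_left_cancel₀ hgcd ?_⟩
    conv_rhs => rw [mul_one, hab]
    linear_combination (exp := 1) (-a) * hp' - b * hq'
  have hW' : wronskian p' q' = 0 := by
    have : g ^ 2 * wronskian p' q' = 0 := by
      rw [← hW, hp', hq']
      simp only [wronskian, derivative_mul]; ring
    exact (mul_eq_zero.1 this).resolve_left (pow_ne_zero _ hgcd)
  obtain ⟨hdp, hdq⟩ := hcop.wronskian_eq_zero_iff.1 hW'
  obtain ⟨a, rfl⟩ : ∃ a, p' = C a := ⟨_, eq_C_of_derivative_eq_zero hdp⟩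
  obtain ⟨b, rfl⟩ : ∃ b, q' = C b := ⟨_, eq_C_of_derivative_eq_zero hdq⟩
  have hab : (a : ℝ) - α * b ≠ 0 := by
    intro h0
    by_cases hb : b = 0
    · subst hb
      have : a = 0 := by simpa using h0
      subst this
      rw [C_0] at hcop
      exact not_isCoprime_zero_zero hcop
    · refine hirr ⟨a / b, ?_⟩
      have : (b : ℝ) ≠ 0 := by exact_mod_cast hb
      push_cast
      field_simp
      linarith
  have hdvd : (X - C α) ^ k ∣ g.map (algebraMap ℚ ℝ) := by
    have : p.map (algebraMap ℚ ℝ) - C α * q.map (algebraMap ℚ ℝ) =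
        g.map (algebraMap ℚ ℝ) * C ((a : ℝ) - α * b) := by
      rw [hp', hq']
      simp; ring
    rw [this] at h
    exact (IsUnit.dvd_mul_right (isUnit_C.2 hab.isUnit)).1 h
  have hdeg := natDegree_le_of_dvd (pow_dvd_of_X_sub_C_pow_dvd hf hα k g hdvd) hgcd
  rw [natDegree_pow] at hdeg
  have hgM : g.natDegree < M := by
    rcases hpq with h0 | h0
    · exact (natDegree_le_of_dvd ⟨_, hp'⟩ h0).trans_lt ((natDegree_lt_iff_degree_lt h0).2 hp)
    · exact (natDegree_le_of_dvd ⟨_, hq'⟩ h0).trans_lt ((natDegree_lt_iff_degree_lt h0).2 hq)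
  rw [mul_comm] at hM
  omega

theorem exists_hasseDeriv_eval_ne_zero {f : ℚ[X]} (hf : Irreducible f) {α : ℝ}
    (hα : aeval α f = 0) (hirr : Irrational α) {p q : ℚ[X]} (hpq : p ≠ 0 ∨ q ≠ 0) {M k T : ℕ}
    (hp : p.degree < M) (hq : q.degree < M) (hM : M ≤ f.natDegree * k)
    (h : (X - C α) ^ k ∣ p.map (algebraMap ℚ ℝ) - C α * q.map (algebraMap ℚ ℝ))
    (hT : 2 * M ≤ f.natDegree * (k - 1) + T) {x : ℚ} (hx : f.eval x ≠ 0) (y : ℚ) :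
    ∃ j < T, (hasseDeriv j (p - C y * q)).eval x ≠ 0 := by
  by_contra! hcon
  have hW := wronskian_ne_zero_of_X_sub_C_pow_dvd hf hα hirr hpq hp hq hM h
  have hW1 : f ^ (k - 1) ∣ wronskian p q := by
    apply pow_dvd_of_X_sub_C_pow_dvd hf hα
    rw [wronskian_map, ← wronskian_sub_C_mul _ _ α]
    exact pow_sub_one_dvd_wronskian _ h
  have hW2 : (X - C x) ^ (T - 1) ∣ wronskian p q := by
    rw [← wronskian_sub_C_mul _ _ y]
    exact pow_sub_one_dvd_wronskian _ (X_sub_C_pow_dvd_iff_hasseDeriv.2 hcon)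
  have hcop : IsCoprime (f ^ (k - 1)) ((X - C x) ^ (T - 1)) := by
    apply IsCoprime.pow
    rw [isCoprime_comm, (irreducible_X_sub_C x).coprime_iff_not_dvd, dvd_iff_isRoot]
    exact hx
  have hdeg := natDegree_le_of_dvd (hcop.mul_dvd hW1 hW2) hW
  rw [natDegree_mul (pow_ne_zero _ hf.ne_zero) (pow_ne_zero _ (X_sub_C_ne_zero x)),
    natDegree_pow, natDegree_pow, natDegree_X_sub_C, mul_comm] at hdeg
  have hlt := natDegree_wronskian_lt_add hW
  have hp0 : p ≠ 0 := by rintro rfl; simp at hW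
  have hq0 : q ≠ 0 := by rintro rfl; simp at hW
  rw [← natDegree_lt_iff_degree_lt hp0] at hp
  rw [← natDegree_lt_iff_degree_lt hq0] at hq
  omega

theorem abs_sum_choose_mul_le {c : ℕ → ℝ} {M j : ℕ} {E : ℝ} (hE : 0 ≤ E)
    (hc : ∀ i < M, |c i| ≤ E) : |∑ i ∈ Finset.range M, (i.choose j : ℝ) * c i| ≤ 4 ^ M * E := by
  calc _ ≤ ∑ i ∈ Finset.range M, |(i.choose j : ℝ) * c i| := Finset.abs_sum_le_sum_abs _ _
    _ ≤ ∑ i ∈ Finset.range M, 2 ^ M * E := by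
      refine Finset.sum_le_sum fun i hi => ?_
      have hi := Finset.mem_range.1 hi
      rw [abs_mul, Nat.abs_cast]
      refine mul_le_mul ?_ (hc i hi) (abs_nonneg _) (by positivity)
      exact_mod_cast (Nat.choose_le_two_pow i j).trans (Nat.pow_le_pow_right (by norm_num) hi.le)
    _ = M * 2 ^ M * E := by simp; ring
    _ ≤ 2 ^ M * 2 ^ M * E := by
      gcongr
      exact_mod_cast (Nat.lt_two_pow_self (n := M)).le
    _ = _ := by rw [← mul_pow]; norm_num

theorem abs_eval_hasseDeriv_le {p : ℝ[X]} {M : ℕ} (hp : p.degree < M) {B A x : ℝ}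
    (hB : ∀ i, |p.coeff i| ≤ B) (hA : 1 ≤ A) (hx : |x| ≤ A) (j : ℕ) :
    |(hasseDeriv j p).eval x| ≤ (4 * A) ^ M * B := by
  have hB0 : 0 ≤ B := (abs_nonneg _).trans (hB 0)
  rw [eval_hasseDeriv_eq_sum hp, mul_pow, mul_assoc]
  simp_rw [mul_assoc]
  refine abs_sum_choose_mul_le (by positivity) fun i hi => ?_
  rw [abs_mul, abs_pow, mul_comm]
  refine mul_le_mul ?_ (hB i) (abs_nonneg _) (by positivity)
  exact (pow_le_pow_left₀ (abs_nonneg _) hx _).trans (pow_le_pow_right₀ hA (by omega))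

theorem abs_eval_hasseDeriv_le_of_dvd {p : ℝ[X]} {M k : ℕ} (hp : p.degree < M) {B A x α : ℝ}
    (hB : ∀ i, |p.coeff i| ≤ B) (hA : 1 ≤ A) (hα : |α| ≤ A) (hx : |x - α| ≤ 1)
    (hdvd : (X - C α) ^ k ∣ p) (j : ℕ) :
    |(hasseDeriv j p).eval x| ≤ (16 * A) ^ M * B * |x - α| ^ (k - j) := by
  have hB0 : 0 ≤ B := (abs_nonneg _).trans (hB 0)
  rw [← taylor_coeff, show x = (x - α) + α by ring, ← taylor_taylor, taylor_coeff,
    add_sub_cancel_right,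
    eval_hasseDeriv_eq_sum (M := M) (by rwa [degree_taylor])]
  simp_rw [mul_assoc]
  rw [show (16 * A) ^ M = 4 ^ M * (4 * A) ^ M by rw [← mul_pow]; ring, mul_assoc]
  refine abs_sum_choose_mul_le (by positivity) fun i hi => ?_
  rw [taylor_coeff]
  by_cases hik : i < k
  · rw [X_sub_C_pow_dvd_iff_hasseDeriv.1 hdvd i hik]
    simp; positivity
  · rw [abs_mul, abs_pow, ← mul_assoc]
    refine mul_le_mul (abs_eval_hasseDeriv_le hp hB hA hα i) ?_ (by positivity) (by positivity)
    exact pow_le_pow_of_le_one (abs_nonneg _) hx (by omega)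

theorem one_le_of_eval_hasseDeriv_ne_zero {P Q : ℤ[X]} {M k : ℕ} (hM : 1 ≤ M)
    (hP : P.degree < M) (hQ : Q.degree < M)
    {B α : ℝ} (hPB : ∀ i, |(P.coeff i : ℝ)| ≤ B) (hQB : ∀ i, |(Q.coeff i : ℝ)| ≤ B)
    (hdvd : (X - C α) ^ k ∣
      P.map (algebraMap ℤ ℝ) - C α * Q.map (algebraMap ℤ ℝ))
    {a₁ b₁ a₂ b₂ : ℤ} (hb₁ : 0 < b₁) (hb₂ : 0 < b₂) (h₁ : |α - a₁ / b₁| ≤ 1) {j : ℕ}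
    (hj : (hasseDeriv j (P.map (algebraMap ℤ ℝ) - C (a₂ / b₂ : ℝ) * Q.map (algebraMap ℤ ℝ))).eval
      (a₁ / b₁ : ℝ) ≠ 0) :
    1 ≤ (b₁ : ℝ) ^ M * b₂ * ((16 * (1 + |α|) ^ 2) ^ M * B *
      (|α - a₁ / b₁| ^ (k - j) + |α - a₂ / b₂|)) := by
  have hB0 : 0 ≤ B := (abs_nonneg _).trans (hPB 0)
  have hb₁' : (1 : ℝ) ≤ b₁ := by exact_mod_cast hb₁
  have hb₂' : (0 : ℝ) < b₂ := by exact_mod_cast hb₂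
  set x : ℝ := a₁ / b₁ with hx
  set y : ℝ := a₂ / b₂ with hy
  set p := P.map (algebraMap ℤ ℝ) with hp
  set q := Q.map (algebraMap ℤ ℝ) with hq
  have hpd : p.degree < M := degree_map_le.trans_lt hP
  have hqd : q.degree < M := degree_map_le.trans_lt hQ
  have hpB : ∀ i, |p.coeff i| ≤ B := fun i => by simpa [p] using hPB i
  have hqB : ∀ i, |q.coeff i| ≤ B := fun i => by simpa [q] using hQB i
  have hA : 1 ≤ 1 + |α| := by linarith [abs_nonneg α]
  have hAA : (1 + |α|) * B ≤ (1 + |α|) ^ M * B := by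
    gcongr
    exact le_self_pow₀ hA (by omega)
  set G : ℤ[X] := hasseDeriv j (C b₂ * P - C a₂ * Q) with hG
  have hGmap : G.map (algebraMap ℤ ℝ) = C (b₂ : ℝ) * hasseDeriv j (p - C y * q) := by
    rw [hG, map_hasseDeriv, ← smul_eq_C_mul (b₂ : ℝ), ← map_smul, smul_sub, smul_eq_C_mul,
      smul_eq_C_mul, ← mul_assoc, ← C_mul, hy, mul_div_cancel₀ _ hb₂'.ne']
    simp [p, q]
  have hGdeg : G.natDegree ≤ M := by
    refine (natDegree_hasseDeriv_le _ _).trans ((Nat.sub_le _ _).trans ?_)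
    have : (C b₂ * P - C a₂ * Q).degree < M := (degree_sub_le _ _).trans_lt
      (max_lt (by
        rw [← smul_eq_C_mul]
        exact (degree_smul_le _ _).trans_lt hP) (by
        rw [← smul_eq_C_mul]
        exact (degree_smul_le _ _).trans_lt hQ))
    exact natDegree_le_of_degree_le this.le
  have hlow := one_le_pow_mul_abs_eval_div (K := ℝ) (f := G) (a := a₁) hb₁ (by
    rw [hGmap, eval_mul, eval_C]
    exact mul_ne_zero hb₂'.ne' hj)
  rw [hGmap, eval_mul, eval_C, abs_mul, abs_of_pos hb₂', ← mul_assoc] at hlow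
  refine hlow.trans ?_
  have hsplit : (hasseDeriv j (p - C y * q)).eval x =
      (hasseDeriv j (p - C α * q)).eval x + (α - y) * (hasseDeriv j q).eval x := by
    simp only [← smul_eq_C_mul, map_sub, map_smul, eval_sub, eval_smul, smul_eq_mul]; ring
  have hxα : |x - α| ≤ 1 := by rwa [abs_sub_comm]
  have e1 := abs_eval_hasseDeriv_le_of_dvd (p := p - C α * q) (M := M) (A := 1 + |α|)
    (B := (1 + |α|) ^ M * B) (x := x)
    ((degree_sub_le _ _).trans_lt (max_lt hpd (by
        rw [← smul_eq_C_mul]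
        exact (degree_smul_le _ _).trans_lt hqd)))
    (fun i => by
      rw [coeff_sub, coeff_C_mul]
      refine (abs_sub _ _).trans (le_trans ?_ hAA)
      rw [abs_mul]
      nlinarith [hpB i, mul_le_mul_of_nonneg_left (hqB i) (abs_nonneg α)])
    hA (by linarith) hxα hdvd j
  have e2 := abs_eval_hasseDeriv_le (x := x) hqd hqB hA
    (by linarith [abs_sub_abs_le_abs_sub x α]) j
  have e2' : |(hasseDeriv j q).eval x| ≤ (16 * (1 + |α|) ^ 2) ^ M * B := by
    refine e2.trans ?_
    gcongr ?_ ^ M * B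
    nlinarith [abs_nonneg α]
  gcongr ?_ * b₂ * ?_
  · exact pow_le_pow_right₀ hb₁' hGdeg
  · rw [hsplit, mul_add]
    refine (abs_add_le _ _).trans (add_le_add ?_ ?_)
    · rw [abs_sub_comm α x]
      refine e1.trans (le_of_eq ?_)
      rw [← mul_assoc, ← mul_pow]; ring
    · rw [abs_mul, mul_comm]
      gcongr

theorem eval_ne_zero_of_irrational_root {f : ℚ[X]} (hf : Irreducible f) {α : ℝ}
    (hα : aeval α f = 0) (hirr : Irrational α) (x : ℚ) : f.eval x ≠ 0 := by
  intro hx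
  have hass := (irreducible_X_sub_C x).associated_of_dvd hf (dvd_iff_isRoot.2 hx)
  have := aeval_eq_zero_of_dvd_aeval_eq_zero hass.symm.dvd hα
  refine hirr ⟨x, ?_⟩
  simp [sub_eq_zero] at this
  exact this.symm

theorem mul_add_lt_one {d N s j : ℕ} {b₁ b₂ δ₁ δ₂ E ε ρ : ℝ} (hb₁ : 1 < b₁) (hb₂ : 1 ≤ b₂)
    (hEpos : 0 < E) (hb₁E : 2 * E < b₁) (hρ_def : ρ = d / 2 + 1 + ε) (hρ1 : 1 ≤ ρ)
    (hNε : d + 2 * ρ * d + 2 ≤ 2 * ε * N) (hs1 : 1 ≤ s) (hsR : 2 * N + ρ * d ≤ s)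
    (hlow : b₁ ^ (2 * N * s) ≤ b₂) (hup : b₂ ≤ b₁ ^ (2 * N * (s + 1))) (hjT : j < 2 * d * s + d)
    (hδ₁0 : 0 ≤ δ₁) (h₁ : δ₁ ≤ b₁ ^ (-ρ)) (h₂ : δ₂ ≤ b₂ ^ (-ρ)) :
    b₁ ^ (d * (N + 1) * s) * b₂ * (E ^ s * (δ₁ ^ (2 * N * s - j) + δ₂)) < 1 := by
  have hb₁0 : 0 < b₁ := by linarith
  have hs1R : (1 : ℝ) ≤ s := by exact_mod_cast hs1
  set M := d * (N + 1) * s with hM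
  set k := 2 * N * s with hk
  have hkR : (k : ℝ) = 2 * N * s := by rw [hk]; push_cast; ring
  have hMR : (M : ℝ) = d * (N + 1) * s := by rw [hM]; push_cast; ring
  have hlow' : (b₁ : ℝ) ^ (k : ℝ) ≤ b₂ := by
    rw [Real.rpow_natCast, hk]; exact hlow
  have hup' : (b₂ : ℝ) ≤ b₁ ^ (k + 2 * N : ℝ) := by
    rw [show (k + 2 * N : ℝ) = ((2 * N * (s + 1) : ℕ) : ℝ) by rw [hkR]; push_cast; ring,
      Real.rpow_natCast]
    exact hup
  have hδ₁' : δ₁ ^ (k - j) ≤ (b₁ : ℝ) ^ (-ρ * (k - (2 * d * s + d))) := by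
    refine (pow_le_pow_left₀ hδ₁0 h₁ _).trans ?_
    rw [← Real.rpow_mul_natCast hb₁0.le]
    refine Real.rpow_le_rpow_of_exponent_le hb₁.le ?_
    have h1 : (k : ℝ) - j ≤ ((k - j : ℕ) : ℝ) := by
      rw [sub_le_iff_le_add]; exact_mod_cast (by omega : k ≤ k - j + j)
    have h2 : (j : ℝ) ≤ 2 * d * s + d := by exact_mod_cast hjT.le
    rw [neg_mul, neg_mul, neg_le_neg_iff]
    exact mul_le_mul_of_nonneg_left (by linarith) (by linarith)
  have hδ₂ : b₂ * δ₂ ≤ (b₁ : ℝ) ^ (k * (1 - ρ)) := by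
    calc b₂ * δ₂ ≤ b₂ * (b₂ : ℝ) ^ (-ρ) := by gcongr
      _ = (b₂ : ℝ) ^ (1 - ρ) := by
        rw [sub_eq_add_neg, Real.rpow_add (by linarith), Real.rpow_one]
      _ ≤ ((b₁ : ℝ) ^ (k : ℝ)) ^ (1 - ρ) :=
        Real.rpow_le_rpow_of_nonpos (by positivity) hlow' (by linarith)
      _ = _ := by rw [← Real.rpow_mul hb₁0.le]
  have hNεs : 0 ≤ (2 * ε * N - (d + 2 * ρ * d + 2)) * (s : ℝ) :=
    mul_nonneg (by linarith) (by linarith)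
  have hρds : 0 ≤ ρ * d * s := by positivity
  have t₁ : (b₁ : ℝ) ^ M * (b₂ * δ₁ ^ (k - j)) ≤ (b₁ : ℝ) ^ (-s : ℝ) := by
    calc _ ≤ (b₁ : ℝ) ^ (M : ℝ) * ((b₁ : ℝ) ^ (k + 2 * N : ℝ) *
          (b₁ : ℝ) ^ (-ρ * (k - (2 * d * s + d)))) := by
          rw [Real.rpow_natCast]; gcongr
      _ = (b₁ : ℝ) ^ (M + (k + 2 * N + -ρ * (k - (2 * d * s + d))) : ℝ) := by
          rw [← Real.rpow_add hb₁0, ← Real.rpow_add hb₁0]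
      _ ≤ _ := by
          refine Real.rpow_le_rpow_of_exponent_le hb₁.le ?_
          rw [hkR, hMR]
          have : ρ * (2 * N * s) = d * N * s + 2 * N * s + 2 * ε * N * s := by rw [hρ_def]; ring
          linarith
  have t₂ : (b₁ : ℝ) ^ M * (b₂ * δ₂) ≤ (b₁ : ℝ) ^ (-s : ℝ) := by
    calc _ ≤ (b₁ : ℝ) ^ (M : ℝ) * (b₁ : ℝ) ^ (k * (1 - ρ)) := by
          rw [Real.rpow_natCast]; gcongr
      _ = (b₁ : ℝ) ^ (M + k * (1 - ρ)) := by rw [← Real.rpow_add hb₁0]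
      _ ≤ _ := by
          refine Real.rpow_le_rpow_of_exponent_le hb₁.le ?_
          rw [hkR, hMR]
          have : ρ * (2 * N * s) = d * N * s + 2 * N * s + 2 * ε * N * s := by rw [hρ_def]; ring
          linarith
  by_contra! key
  have hfinal : (1 : ℝ) ≤ E ^ s * (2 * (b₁ : ℝ) ^ (-s : ℝ)) := by
    refine key.trans ?_
    calc _ = E ^ s * ((b₁ : ℝ) ^ M * (b₂ * δ₁ ^ (k - j)) +
          (b₁ : ℝ) ^ M * (b₂ * δ₂)) := by ring
      _ ≤ _ := by gcongr; linarith
  rw [Real.rpow_neg hb₁0.le, Real.rpow_natCast] at hfinal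
  have hlt : 2 * E ^ s < (b₁ : ℝ) ^ s := calc
    2 * E ^ s ≤ 2 ^ s * E ^ s := by gcongr; exact le_self_pow₀ (by norm_num) (by omega)
    _ = (2 * E) ^ s := (mul_pow _ _ _).symm
    _ < _ := pow_lt_pow_left₀ hb₁E (by positivity) (by omega)
  have hbs : (0 : ℝ) < b₁ ^ s := by positivity
  rw [show E ^ s * (2 * ((b₁ : ℝ) ^ s)⁻¹) = 2 * E ^ s / b₁ ^ s by field_simp,
    le_div_iff₀ hbs] at hfinal
  linarith

/-- Thue's theorem for algebraic integers. -/
theorem not_liouvilleWith_of_monic {f : ℤ[X]} (hf : f.Monic)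
    (hfi : Irreducible (f.map (algebraMap ℤ ℚ))) {α : ℝ} (hα : aeval α f = 0)
    (hirr : Irrational α) {κ : ℝ} (hκ : (f.natDegree : ℝ) / 2 + 1 < κ) : ¬ LiouvilleWith κ α := by
  intro hL
  have hαQ : aeval α (f.map (algebraMap ℤ ℚ)) = 0 := by rwa [aeval_map_algebraMap]
  have hdQ : (f.map (algebraMap ℤ ℚ)).natDegree = f.natDegree := hf.natDegree_map _
  have hd : 1 ≤ f.natDegree := hdQ ▸ hfi.natDegree_pos
  set d := f.natDegree with hd_def
  obtain ⟨ρ, hρ, hρκ⟩ := exists_between hκ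
  have hfreq := hL.frequently_lt_rpow_neg hρκ
  obtain ⟨ε, hε, rfl⟩ : ∃ ε : ℝ, 0 < ε ∧ ρ = d / 2 + 1 + ε :=
    ⟨ρ - (d / 2 + 1), by linarith, by ring⟩
  set ρ : ℝ := d / 2 + 1 + ε with hρ_def
  have hρ1 : 1 < ρ := by have : (0 : ℝ) ≤ d := by positivity
                         linarith
  obtain ⟨N, hN⟩ := exists_nat_ge (max 1 ((d + 2 * ρ * d + 2) / (2 * ε)))
  have hN1 : 1 ≤ N := by exact_mod_cast (le_max_left _ _).trans hN
  have hNε : d + 2 * ρ * d + 2 ≤ 2 * ε * N := by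
    have := (div_le_iff₀ (by positivity)).1 ((le_max_right _ _).trans hN)
    linarith
  obtain ⟨K, hK, haux⟩ := exists_auxiliary_pair hf hd hα N hN1
  set L : ℝ := 16 * (1 + |α|) ^ 2 with hL_def
  have hLpos : 0 < L := by positivity
  set E : ℝ := L ^ (d * (N + 1)) * K with hE
  have hEpos : 0 < E := by positivity
  obtain ⟨b₁, ⟨a₁, -, h₁⟩, hb₁⟩ := (hfreq.and_eventually
    (Filter.eventually_gt_atTop (max 1 ⌈2 * E⌉₊))).exists
  have hb₁1 : 1 < b₁ := (le_max_left _ _).trans_lt hb₁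
  have hb₁E : 2 * E < b₁ := (Nat.le_ceil _).trans_lt
    (by exact_mod_cast (le_max_right _ _).trans_lt hb₁)
  obtain ⟨s₀, hs₀⟩ := exists_nat_ge (2 * N + ρ * d + 1 : ℝ)
  have hβ : 1 < b₁ ^ (2 * N) := Nat.one_lt_pow (by omega) hb₁1
  obtain ⟨b₂, ⟨a₂, -, h₂⟩, hb₂⟩ := (hfreq.and_eventually
    (Filter.eventually_ge_atTop ((b₁ ^ (2 * N)) ^ s₀))).exists
  have hb₂0 : 0 < b₂ := (pow_pos (by omega) _).trans_le hb₂
  set s := Nat.log (b₁ ^ (2 * N)) b₂ with hs_def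
  have hs₀s : s₀ ≤ s := Nat.le_log_of_pow_le hβ hb₂
  have hslow : (b₁ ^ (2 * N)) ^ s ≤ b₂ := Nat.pow_log_le_self _ hb₂0.ne'
  have hsup : b₂ < (b₁ ^ (2 * N)) ^ (s + 1) := Nat.lt_pow_succ_log_self hβ _
  have hsR : 2 * N + ρ * d + 1 ≤ (s : ℝ) := hs₀.trans (by exact_mod_cast hs₀s)
  have hs1R : (1 : ℝ) ≤ s := by
    have : 0 ≤ 2 * N + ρ * d := by positivity
    linarith
  have hs1 : 1 ≤ s := by exact_mod_cast hs1R
  obtain ⟨P, Q, hPQ, hPd, hQd, hPc, hQc, hdvd⟩ := haux s hs1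
  set M := d * (N + 1) * s with hM
  have hM1 : 1 ≤ M := Nat.mul_pos (Nat.mul_pos hd (by omega)) hs1
  have hinj : Function.Injective (algebraMap ℤ ℚ) := (algebraMap ℤ ℚ).injective_int
  have hcomp : (algebraMap ℚ ℝ).comp (algebraMap ℤ ℚ) = algebraMap ℤ ℝ := RingHom.ext_int _ _
  obtain ⟨j, hjT, hj⟩ := exists_hasseDeriv_eval_ne_zero hfi hαQ hirr
    (p := P.map (algebraMap ℤ ℚ)) (q := Q.map (algebraMap ℤ ℚ)) (M := M) (k := 2 * N * s)
    (T := 2 * d * s + d)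
    (by simpa only [Ne, Polynomial.map_eq_zero_iff hinj] using hPQ)
    (degree_map_le.trans_lt hPd) (degree_map_le.trans_lt hQd)
    (by rw [hdQ, hM]; nlinarith [Nat.mul_le_mul_left (d * s) hN1])
    (by rwa [Polynomial.map_map, Polynomial.map_map, hcomp])
    (by
      obtain ⟨k, hk⟩ : ∃ k, 2 * N * s = k + 1 :=
        Nat.exists_eq_succ_of_ne_zero (Nat.mul_pos (by omega) hs1).ne'
      rw [hdQ, hM, hk, Nat.add_sub_cancel]
      nlinarith)
    (x := a₁ / b₁) (eval_ne_zero_of_irrational_root hfi hαQ hirr _) (a₂ / b₂)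
  have hb₁R : (1 : ℝ) < b₁ := by exact_mod_cast hb₁1
  have hb₁0 : (0 : ℝ) < b₁ := by linarith
  have hb₂R : (1 : ℝ) ≤ b₂ := by exact_mod_cast hb₂0
  have key := one_le_of_eval_hasseDeriv_ne_zero hM1 hPd hQd hPc hQc hdvd (a₁ := a₁) (b₁ := b₁)
    (a₂ := a₂) (b₂ := b₂) (by exact_mod_cast hb₁1.le) (by exact_mod_cast hb₂0)
    (by
      rw [Int.cast_natCast]
      exact h₁.le.trans (Real.rpow_le_one_of_one_le_of_nonpos hb₁R.le (by linarith))) (j := j)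
    (by
      have h := (map_ne_zero (algebraMap ℚ ℝ)).2 hj
      rw [← eval₂_at_apply, ← eval_map, map_hasseDeriv, Polynomial.map_sub, Polynomial.map_mul,
        Polynomial.map_map, Polynomial.map_map, hcomp, map_C] at h
      simpa using h)
  simp only [Int.cast_natCast] at key
  have hE' : L ^ M * K ^ s = E ^ s := by rw [hE, mul_pow (L ^ (d * (N + 1))) K s, ← pow_mul]
  rw [hE'] at key
  exact key.not_gt (mul_add_lt_one hb₁R hb₂R hEpos hb₁E hρ_def hρ1.le hNε hs1 (by linarith)
    (by rw [pow_mul]; exact_mod_cast hslow) (by rw [pow_mul]; exact_mod_cast hsup.le) hjT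
    (abs_nonneg _) h₁.le h₂.le)

/-- **Thue's theorem**: an irrational root of a polynomial of degree `d` over `ℚ` is not
approximable with any exponent larger than `d / 2 + 1`. -/
theorem not_liouvilleWith_of_aeval_eq_zero {f : ℚ[X]} (hf : f ≠ 0) {α : ℝ} (hα : aeval α f = 0)
    (hirr : Irrational α) {κ : ℝ} (hκ : (f.natDegree : ℝ) / 2 + 1 < κ) : ¬ LiouvilleWith κ α := by
  intro hL
  have halg : IsAlgebraic ℤ α := (IsFractionRing.isAlgebraic_iff ℤ ℚ ℝ).2 ⟨f, hf, hα⟩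
  obtain ⟨y, hy, hint⟩ := halg.exists_integral_multiple
  rw [zsmul_eq_mul] at hint
  have hmin := minpoly.isIntegrallyClosed_eq_field_fractions' ℚ hint
  have hdeg : (minpoly ℤ ((y : ℝ) * α)).natDegree ≤ f.natDegree := by
    rw [← (minpoly.monic hint).natDegree_map (algebraMap ℤ ℚ), ← hmin]
    have hy' : (y : ℚ)⁻¹ ≠ 0 := inv_ne_zero (by exact_mod_cast hy)
    have hcomp : (f.comp (C (y : ℚ)⁻¹ * X)).natDegree = f.natDegree := by
      rw [natDegree_comp, natDegree_C_mul_X _ hy', mul_one]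
    rw [← hcomp]
    refine natDegree_le_of_dvd (minpoly.dvd ℚ _ ?_) ?_
    · have hyR : (y : ℝ) ≠ 0 := by exact_mod_cast hy
      rw [aeval_comp]
      simpa [hyR] using hα
    · rw [Ne, comp_C_mul_X_eq_zero_iff (mem_nonZeroDivisors_of_ne_zero hy')]
      exact hf
  refine not_liouvilleWith_of_monic (minpoly.monic hint) (hmin ▸ minpoly.irreducible hint.tower_top)
    (minpoly.aeval _ _) (hirr.intCast_mul hy) (κ := κ) (lt_of_le_of_lt ?_ hκ) (hL.int_mul hy)
  gcongr

theorem exists_pos_mul_rpow_le_abs_sub {α κ : ℝ} (hirr : Irrational α)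
    (hL : ¬ LiouvilleWith κ α) (hκ : 0 ≤ κ) :
    ∃ c : ℝ, 0 < c ∧ ∀ a b : ℤ, b ≠ 0 → c * |(b : ℝ)| ^ (-κ) ≤ |α - a / b| := by
  obtain ⟨n₀, hn₀⟩ : ∃ n₀ : ℕ, ∀ n ≥ n₀, ∀ m : ℤ, (n : ℝ) ^ (-κ) ≤ |α - m / n| := by
    simp only [LiouvilleWith, not_exists, Filter.not_frequently] at hL
    obtain ⟨n₀, h⟩ := Filter.eventually_atTop.1 (hL 1)
    refine ⟨max n₀ 1, fun n hn m => ?_⟩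
    have hne : α ≠ m / n := hirr.ne_rational m n |> fun h => by exact_mod_cast h
    have := not_lt.1 fun hlt => h n ((le_max_left _ _).trans hn) m ⟨hne, hlt⟩
    rwa [one_div, ← Real.rpow_neg (by positivity)] at this
  obtain ⟨c, hc, hc0⟩ := (((hirr.eventually_forall_le_dist_cast_div_of_denom_le n₀).filter_mono
    nhdsWithin_le_nhds).and (self_mem_nhdsWithin (s := Set.Ioi (0 : ℝ)))).exists
  have hnat : ∀ n : ℕ, n ≠ 0 → ∀ m : ℤ, min c 1 * (n : ℝ) ^ (-κ) ≤ |α - m / n| := by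
    intro n hn m
    have hn1 : (1 : ℝ) ≤ n := by exact_mod_cast Nat.one_le_iff_ne_zero.2 hn
    rcases le_total n₀ n with h | h
    · exact (mul_le_of_le_one_left (by positivity) (min_le_right _ _)).trans (hn₀ n h m)
    · refine le_trans ?_ (hc n h m)
      refine (mul_le_of_le_one_right (le_min hc0.le zero_le_one) ?_).trans (min_le_left _ _)
      exact Real.rpow_le_one_of_one_le_of_nonpos hn1 (by linarith)
  refine ⟨min c 1, lt_min hc0 one_pos, fun a b hb => ?_⟩
  have hcast : ((b.natAbs : ℕ) : ℝ) = |(b : ℝ)| := by rw [Nat.cast_natAbs, Int.cast_abs]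
  rw [← hcast]
  rcases Int.natAbs_eq b with h | h
  · convert hnat b.natAbs (by omega) a using 4
    exact (congrArg (Int.cast : ℤ → ℝ) h).trans (Int.cast_natCast _)
  · convert hnat b.natAbs (by omega) (-a) using 3
    rw [Int.cast_neg, ← neg_div_neg_eq]
    congr 1
    rw [← Int.cast_neg, ← Int.cast_natCast (R := ℝ)]
    congr 1
    omega

theorem irrational_of_irreducible_of_aeval_eq_zero {f : ℚ[X]} (hf : Irreducible f)
    (hd : 2 ≤ f.natDegree) {α : ℝ} (hα : aeval α f = 0) : Irrational α := by
  rintro ⟨x, rfl⟩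
  have hx : f.IsRoot x := by
    have h := aeval_algebraMap_apply ℝ x f
    rw [eq_ratCast, hα] at h
    exact (map_eq_zero (algebraMap ℚ ℝ)).1 h.symm
  have : f.natDegree = 1 :=
    natDegree_eq_of_degree_eq_some (degree_eq_one_of_irreducible_of_root hf hx)
  omega

theorem homogenize_not_isUnit {K : Type*} [Field K] (g : K[X]) {n : ℕ} (hn : n ≠ 0) :
    ¬ IsUnit (g.homogenize n) := by
  intro h
  have := h.map MvPolynomial.constantCoeff
  rw [MvPolynomial.constantCoeff_eq, coeff_homogenize, if_neg (by simpa using hn.symm)] at this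
  exact not_isUnit_zero this

theorem irreducible_of_irreducible_homogenize {K : Type*} [Field K] {f : K[X]} {p : ℕ}
    (hp : 2 ≤ p) (hfp : f.natDegree ≤ p) (h : Irreducible (f.homogenize p)) :
    f.natDegree = p ∧ Irreducible f := by
  have hsplit : ∀ (g k : K[X]) (m n : ℕ), g.natDegree ≤ m → k.natDegree ≤ n → m + n = p →
      m ≠ 0 → n ≠ 0 → f ≠ g * k := by
    rintro g k m n hg hk rfl hm hn rfl
    rw [homogenize_mul g k hg hk] at h
    exact (h.isUnit_or_isUnit rfl).elim (homogenize_not_isUnit g hm) (homogenize_not_isUnit k hn)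
  have hdeg : f.natDegree = p := by
    by_contra hne
    exact hsplit 1 f 1 (p - 1) (by simp) (by omega) (by omega) one_ne_zero (by omega) (by simp)
  have hf0 : f ≠ 0 := by rintro rfl; simp at hdeg; omega
  refine ⟨hdeg, ⟨fun hu => ?_, fun g k hgk => ?_⟩⟩
  · have := natDegree_eq_zero_of_isUnit hu
    omega
  · have hg0 : g ≠ 0 := by rintro rfl; simp at hgk; exact hf0 hgk
    have hk0 : k ≠ 0 := by rintro rfl; simp at hgk; exact hf0 hgk
    have hsum : g.natDegree + k.natDegree = p := by rw [← natDegree_mul hg0 hk0, ← hgk, hdeg]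
    by_contra! hcon
    refine hsplit g k _ _ le_rfl le_rfl hsum (fun h0 => hcon.1 ?_) (fun h0 => hcon.2 ?_) hgk
    · exact isUnit_iff_degree_eq_zero.2 (degree_eq_natDegree hg0 ▸ by simp [h0])
    · exact isUnit_iff_degree_eq_zero.2 (degree_eq_natDegree hk0 ▸ by simp [h0])

theorem eval_smul_of_isHomogeneous {R : Type*} [CommRing R] {σ : Type*} {φ : MvPolynomial σ R}
    {n : ℕ} (hφ : φ.IsHomogeneous n) (t : R) (x : σ → R) :
    MvPolynomial.eval (t • x) φ = t ^ n * MvPolynomial.eval x φ := by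
  rw [MvPolynomial.eval_eq, MvPolynomial.eval_eq, Finset.mul_sum]
  refine Finset.sum_congr rfl fun d hd => ?_
  have hdeg : ∑ i ∈ d.support, d i = n := by
    rw [← Finsupp.degree_apply, Finsupp.degree_eq_weight_one]
    exact hφ (MvPolynomial.mem_support_iff.1 hd)
  simp only [Pi.smul_apply, smul_eq_mul, mul_pow, Finset.prod_mul_distrib]
  rw [Finset.prod_pow_eq_pow_sum, hdeg]
  ring

theorem eval_homogenize_natDegree_zero {K : Type*} [Field K] (f : K[X]) (x : K) :
    MvPolynomial.eval ![x, 0] (f.homogenize f.natDegree) = f.leadingCoeff * x ^ f.natDegree := by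
  rw [MvPolynomial.eval_eq, Finset.sum_eq_single (Finsupp.single 0 f.natDegree)]
  · by_cases h : f.natDegree = 0
    · simp [h, coeff_homogenize, ← coeff_natDegree]
    · simp [Finsupp.support_single, h, coeff_homogenize]
  · intro d hd hne
    have hsum := sum_eq_natDegree_of_mem_support_homogenize f hd
    have h1 : d 1 ≠ 0 := by
      intro h1
      apply hne
      ext i
      fin_cases i
      · simpa [h1] using hsum
      · simpa using h1
    rw [Finset.prod_eq_zero (i := 1) (by simpa using h1) (by simp [h1]), mul_zero]
  · intro hd
    rw [MvPolynomial.notMem_support_iff.1 hd, zero_mul]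

theorem isCompact_setOf_sq_add_sq_eq_one : IsCompact {w : ℝ × ℝ | w.1 ^ 2 + w.2 ^ 2 = 1} := by
  refine (isCompact_Icc (a := ((-1, -1) : ℝ × ℝ)) (b := (1, 1))).of_isClosed_subset
    (isClosed_eq (by fun_prop) continuous_const) fun w hw => ?_
  have hw : w.1 ^ 2 + w.2 ^ 2 = 1 := hw
  refine ⟨⟨?_, ?_⟩, ⟨?_, ?_⟩⟩ <;> dsimp only <;> nlinarith [sq_nonneg w.1, sq_nonneg w.2]

theorem continuous_eval_pair (φ : MvPolynomial (Fin 2) ℝ) :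
    Continuous fun w : ℝ × ℝ => MvPolynomial.eval ![w.1, w.2] φ :=
  φ.continuous_eval.comp (by fun_prop)

theorem exists_nhds_le_abs_eval_of_ne_zero {φ : MvPolynomial (Fin 2) ℝ} {p : ℕ}
    (hφ : φ.IsHomogeneous p) {w₀ : ℝ × ℝ} (h₀ : MvPolynomial.eval ![w₀.1, w₀.2] φ ≠ 0) {σ : ℝ}
    (hσ : σ ≤ p) :
    ∃ S ∈ nhds w₀, ∃ c : ℝ, 0 < c ∧ ∀ t : ℝ, 1 ≤ t → ∀ w ∈ S,
      c * t ^ σ ≤ |MvPolynomial.eval ![t * w.1, t * w.2] φ| := by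
  have hpos := abs_pos.2 h₀
  refine ⟨_, (continuous_eval_pair φ).abs.continuousAt.eventually_const_le (half_lt_self hpos), _,
    half_pos hpos, fun t ht w hw => ?_⟩
  have ht0 : 0 ≤ t := by linarith
  have h := eval_smul_of_isHomogeneous hφ t ![w.1, w.2]
  simp only [Matrix.smul_cons, smul_eq_mul, Matrix.smul_empty] at h
  rw [h, abs_mul, abs_of_nonneg (pow_nonneg ht0 p), mul_comm]
  have hpow : t ^ σ ≤ t ^ p := by
    rw [← Real.rpow_natCast]
    exact Real.rpow_le_rpow_of_exponent_le ht hσ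
  exact mul_le_mul hpow hw (half_pos hpos).le (pow_nonneg ht0 p)

theorem exists_nhds_le_abs_eval_of_root {f : ℚ[X]} (hf : Irreducible f) (hd : 2 ≤ f.natDegree)
    {w₀ : ℝ × ℝ} (hw₀ : w₀.2 ≠ 0) (hroot : aeval (w₀.1 / w₀.2) f = 0) {σ : ℝ}
    (hσ : σ < f.natDegree / 2 - 1) :
    ∃ S ∈ nhds w₀, ∃ c : ℝ, 0 < c ∧ ∀ a b : ℤ, ∀ t : ℝ, 1 ≤ t → ∀ w ∈ S,
      (a : ℝ) = t * w.1 → (b : ℝ) = t * w.2 →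
        c * t ^ σ ≤ |MvPolynomial.eval ![(a : ℝ), (b : ℝ)]
          ((f.map (algebraMap ℚ ℝ)).homogenize f.natDegree)| := by
  set d := f.natDegree with hd'
  set α := w₀.1 / w₀.2 with hα
  have hirr := irrational_of_irreducible_of_aeval_eq_zero hf hd hroot
  have hκ : (d : ℝ) / 2 + 1 < d - σ := by linarith
  obtain ⟨c, hc, hle⟩ := exists_pos_mul_rpow_le_abs_sub hirr
    (not_liouvilleWith_of_aeval_eq_zero hf.ne_zero hroot hirr hκ)
    (by linarith [d.cast_nonneg (α := ℝ)])
  obtain ⟨u, hu, hu0⟩ := exists_map_eq_X_sub_C_mul hf hroot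
  have hcont : ContinuousAt (fun w : ℝ × ℝ => |w.2| ^ σ * |u.eval (w.1 / w.2)|) w₀ := by
    refine ContinuousAt.mul (ContinuousAt.rpow_const (by fun_prop) (Or.inl (abs_ne_zero.2 hw₀))) ?_
    exact (u.continuous.continuousAt.comp
      (continuousAt_fst.div continuousAt_snd hw₀)).abs
  have hpos : 0 < |w₀.2| ^ σ * |u.eval (w₀.1 / w₀.2)| :=
    mul_pos (Real.rpow_pos_of_pos (abs_pos.2 hw₀) _) (abs_pos.2 hu0)
  refine ⟨_, (hcont.eventually_const_le (half_lt_self hpos)).and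
    (continuousAt_snd.eventually_ne hw₀), _, mul_pos hc (half_pos hpos),
    fun a b t ht w ⟨hw, hw2⟩ ha hb => ?_⟩
  have ht0 : 0 < t := by linarith
  have hbR : (b : ℝ) ≠ 0 := by rw [hb]; exact mul_ne_zero ht0.ne' hw2
  have hb0 : 0 < |(b : ℝ)| := abs_pos.2 hbR
  have hab : (a : ℝ) / b = w.1 / w.2 := by rw [ha, hb, mul_div_mul_left _ _ ht0.ne']
  have h1 := hle a b (by exact_mod_cast hbR)
  rw [eval_homogenize ((natDegree_map_le).trans_eq hd'.symm) _ (by simpa using hbR), hu]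
  simp only [Matrix.cons_val_zero, Matrix.cons_val_one, eval_mul, eval_sub, eval_X, eval_C,
    abs_mul, abs_pow]
  rw [abs_sub_comm]
  have hbpow : |(b : ℝ)| ^ (-((d : ℝ) - σ)) * |(b : ℝ)| ^ d = t ^ σ * |w.2| ^ σ := by
    rw [← Real.rpow_natCast, ← Real.rpow_add hb0, ← Real.mul_rpow ht0.le (abs_nonneg _), hb,
      abs_mul, abs_of_pos ht0]
    congr 1
    ring
  calc c * (|w₀.2| ^ σ * |u.eval (w₀.1 / w₀.2)| / 2) * t ^ σ
      ≤ c * (|w.2| ^ σ * |u.eval (w.1 / w.2)|) * t ^ σ := by gcongr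
    _ = c * |(b : ℝ)| ^ (-((d : ℝ) - σ)) * |u.eval ((a : ℝ) / b)| * |(b : ℝ)| ^ d := by
      rw [hab]
      linear_combination (-c * |u.eval (w.1 / w.2)|) * hbpow
    _ ≤ _ := by gcongr

/-- Lower bound for the values of an irreducible binary form at integer points. -/
theorem exists_pos_mul_rpow_le_abs_eval_homogenize {f : ℚ[X]} (hf : Irreducible f)
    (hd : 2 ≤ f.natDegree) {σ : ℝ} (hσ : σ < f.natDegree / 2 - 1) :
    ∃ c : ℝ, 0 < c ∧ ∀ n : ℤ × ℤ, n ≠ 0 → c * ((n.1 : ℝ) ^ 2 + (n.2 : ℝ) ^ 2) ^ (σ / 2) ≤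
      |MvPolynomial.eval ![(n.1 : ℝ), (n.2 : ℝ)]
        ((f.map (algebraMap ℚ ℝ)).homogenize f.natDegree)| := by
  set φ := (f.map (algebraMap ℚ ℝ)).homogenize f.natDegree with hφ
  obtain ⟨c, hc, h⟩ : ∃ c : ℝ, 0 < c ∧ ∀ a b : ℤ, ∀ t : ℝ, 1 ≤ t →
      ∀ w ∈ {w : ℝ × ℝ | w.1 ^ 2 + w.2 ^ 2 = 1}, (a : ℝ) = t * w.1 → (b : ℝ) = t * w.2 →
        c * t ^ σ ≤ |MvPolynomial.eval ![(a : ℝ), (b : ℝ)] φ| := by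
    refine isCompact_setOf_sq_add_sq_eq_one.induction_on
      (p := fun S => ∃ c : ℝ, 0 < c ∧ ∀ a b : ℤ, ∀ t : ℝ, 1 ≤ t → ∀ w ∈ S,
        (a : ℝ) = t * w.1 → (b : ℝ) = t * w.2 →
          c * t ^ σ ≤ |MvPolynomial.eval ![(a : ℝ), (b : ℝ)] φ|) ⟨1, one_pos, by simp⟩ ?_ ?_ ?_
    · rintro S T hST ⟨c, hc, h⟩
      exact ⟨c, hc, fun a b t ht w hw => h a b t ht w (hST hw)⟩
    · rintro S T ⟨c, hc, h⟩ ⟨c', hc', h'⟩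
      refine ⟨min c c', lt_min hc hc', fun a b t ht w hw ha hb => ?_⟩
      have ht0 : 0 ≤ t ^ σ := Real.rpow_nonneg (by linarith) _
      rcases hw with hw | hw
      · exact (mul_le_mul_of_nonneg_right (min_le_left _ _) ht0).trans (h a b t ht w hw ha hb)
      · exact (mul_le_mul_of_nonneg_right (min_le_right _ _) ht0).trans (h' a b t ht w hw ha hb)
    · intro w₀ hw₀
      by_cases h₀ : MvPolynomial.eval ![w₀.1, w₀.2] φ = 0
      · have hw2 : w₀.2 ≠ 0 := by
          intro hw2
          have hw1 : w₀.1 ≠ 0 := by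
            intro hw1
            simp [hw1, hw2] at hw₀
          have hnat := natDegree_map (algebraMap ℚ ℝ) (p := f)
          rw [hw2, hφ, ← hnat, eval_homogenize_natDegree_zero] at h₀
          exact mul_ne_zero (by simpa using hf.ne_zero) (pow_ne_zero _ hw1) h₀
        have hroot : aeval (w₀.1 / w₀.2) f = 0 := by
          rw [hφ, eval_homogenize natDegree_map_le _ (by simpa using hw2)] at h₀
          rw [aeval_def, ← eval_map]
          exact (mul_eq_zero.1 h₀).resolve_right (pow_ne_zero _ hw2)
        obtain ⟨S, hS, h⟩ := exists_nhds_le_abs_eval_of_root hf hd hw2 hroot hσ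
        exact ⟨S, mem_nhdsWithin_of_mem_nhds hS, h⟩
      · obtain ⟨S, hS, c, hc, h⟩ := exists_nhds_le_abs_eval_of_ne_zero
          (isHomogeneous_homogenize _) h₀ (σ := σ)
          (by linarith [f.natDegree.cast_nonneg (α := ℝ)])
        exact ⟨S, mem_nhdsWithin_of_mem_nhds hS, c, hc,
          fun a b t ht w hw ha hb => by rw [ha, hb]; exact h t ht w hw⟩
  refine ⟨c, hc, fun n hn => ?_⟩
  set s : ℝ := (n.1 : ℝ) ^ 2 + (n.2 : ℝ) ^ 2 with hs
  have hs1 : 1 ≤ s := by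
    have : 0 < n.1 ^ 2 + n.2 ^ 2 := by
      rcases n with ⟨a, b⟩
      simp only [ne_eq, Prod.mk_eq_zero, not_and_or] at hn
      rcases hn with hn | hn <;> positivity
    rw [hs]
    exact_mod_cast this
  have ht0 : √s ≠ 0 := (Real.sqrt_pos.2 (by linarith)).ne'
  have := h n.1 n.2 (√s) (Real.one_le_sqrt.2 hs1) (n.1 / √s, n.2 / √s) (by
      simp only [Set.mem_ofPred_eq, div_pow]
      rw [Real.sq_sqrt (by linarith), ← add_div, ← hs, div_self (by linarith)])
    (by field_simp) (by field_simp)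
  rwa [Real.sqrt_eq_rpow, ← Real.rpow_mul (by linarith), one_div_mul_eq_div] at this

theorem exists_irreducible_homogenize_eq {K : Type*} [Field K] {F : MvPolynomial (Fin 2) K} {p : ℕ}
    (hp : 2 ≤ p) (hF : F.IsHomogeneous p) (hirr : Irreducible F) :
    ∃ f : K[X], Irreducible f ∧ f.natDegree = p ∧ f.homogenize p = F := by
  have h := homogenize_eq_of_isHomogeneous hF rfl
  have hle : (MvPolynomial.aeval ![X, 1] F : K[X]).natDegree ≤ p :=
    (MvPolynomial.aeval_natDegree_le F hF.totalDegree_le _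
      (n := 1) fun i => by fin_cases i <;> simp).trans_eq (mul_one p)
  obtain ⟨hdeg, hf⟩ := irreducible_of_irreducible_homogenize hp hle (h.symm ▸ hirr)
  exact ⟨_, hf, hdeg, h⟩

/-- if `P` is a homogeneous polynomial of degree `p ≥ 2` with integer
coefficients, irreducible over `ℚ`, then for every `ε > 0` there is `C > 0` with
`|P(n₁,n₂)| ≥ C·(n₁² + n₂²)^{(p/2 − 1 − ε)/2}` for all nonzero `(n₁,n₂) ∈ ℤ²`
(equivalently, `L⁻¹ : H^m → H^{m + p/2 − 1 − ε}` continuously, modulo constants). -/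
theorem stmt_12 (p : ℕ) (hp : 2 ≤ p) (P : MvPolynomial (Fin 2) ℤ)
    (hP : P.IsHomogeneous p)
    (hirr : Irreducible (MvPolynomial.map (Int.castRingHom ℚ) P)) :
    ∀ ε : ℝ, 0 < ε → ∃ C : ℝ, 0 < C ∧ ∀ n : ℤ × ℤ, n ≠ 0 →
      C * ((n.1 : ℝ) ^ 2 + (n.2 : ℝ) ^ 2) ^ (((p : ℝ) / 2 - 1 - ε) / 2)
        ≤ |((MvPolynomial.eval ![n.1, n.2] P : ℤ) : ℝ)| := by
  intro ε hε
  obtain ⟨f, hf, rfl, hfP⟩ := exists_irreducible_homogenize_eq hp (hP.map _) hirr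
  obtain ⟨C, hC, h⟩ := exists_pos_mul_rpow_le_abs_eval_homogenize hf hp
    (σ := (f.natDegree : ℝ) / 2 - 1 - ε) (by linarith)
  refine ⟨C, hC, fun n hn => (h n hn).trans_eq ?_⟩
  rw [homogenize_map, hfP, MvPolynomial.map_map, MvPolynomial.eval_map, ← eq_intCast
    (Int.castRingHom ℝ) (MvPolynomial.eval _ _), MvPolynomial.eval, MvPolynomial.coe_eval₂Hom,
    MvPolynomial.hom_eval₂]
  congr 2
  ext i
  fin_cases i <;> simp
end
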